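/- arXiv:0908.1544 — 2 statements merged into one kernel-verified Lean document; each statement's English description precedes it below -/
import Mathlib

section
/- Let Ȧ ⊆ Ḣ and Ä ⊆ Ḧ and let A : Ȧ → Ä be a function whose graph is a Borel subset of Ḣ × Ḧ, with Ȧ and Ä Borel. Then either the graph of A can be covered by countably many graphs of continuous functions, or else there exist maps φ̇ : ω^ω → Ȧ and φ̈ : ω^ω → Ä such that A(φ̇(s)) = φ̈(s) for every s ∈ ω^ω, φ̇ is a topological embedding of ω^ω with the Cantor topology into Ȧ, and φ̈ is a topological embedding of ω^ω with the Baire topology into Ä. -/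
open MeasureTheory Metric Set Topology

noncomputable section

/-- The Hilbert cube `[0,1]^ℕ`. -/
abbrev Hcube : Type := ℕ → unitInterval

/-- `G` is the graph of a continuous function, i.e. a set of the form
`{(x, f x) : x ∈ D}` where `f` is continuous on its domain `D ⊆ Ḣ`. -/
def IsContGraph (G : Set (Hcube × Hcube)) : Prop :=
  ∃ (D : Set Hcube) (f : Hcube → Hcube), ContinuousOn f D ∧
    G = {p : Hcube × Hcube | p.1 ∈ D ∧ p.2 = f p.1}

/-- `X` can be covered by countably many graphs of continuous functions. -/
def CoveredByCtsGraphs (X : Set (Hcube × Hcube)) : Prop :=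
  ∃ G : ℕ → Set (Hcube × Hcube), (∀ n, IsContGraph (G n)) ∧ X ⊆ ⋃ n, G n

/-- The identification of `ω` with `{0} ∪ {2^{-n} : n ≥ 1} ⊆ [0,1]`:
`0 ↦ 0` and `n ↦ 2^{-n}` for `n ≥ 1`. -/
def cantorEmbNat : ℕ → ℝ := fun n => if n = 0 then 0 else (2 : ℝ) ^ (-(n : ℤ))

/-- The Cantor topology on `ω^ω`, induced by the coordinatewise identification of `ω`
with `{0} ∪ {2^{-n} : n ≥ 1}` and the product topology. -/
def cantorTop : TopologicalSpace (ℕ → ℕ) :=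
  TopologicalSpace.induced (fun (s : ℕ → ℕ) (n : ℕ) => cantorEmbNat (s n)) inferInstance

section core
variable {Z X Y : Type*} [MetricSpace Z] [MetricSpace X] [MetricSpace Y]

def CtsOnSet (p : Z → X) (q : Z → Y) (T : Set Z) : Prop :=
  ∀ z ∈ T, ∀ O ∈ 𝓝 (q z), ∃ Q ∈ 𝓝 (p z), ∀ z' ∈ T, p z' ∈ Q → q z' ∈ O

def Sm (p : Z → X) (q : Z → Y) (S : Set Z) : Prop :=
  ∃ T : ℕ → Set Z, (∀ n, CtsOnSet p q (T n)) ∧ S ⊆ ⋃ n, T n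

theorem Sm.mono {p : Z → X} {q : Z → Y} {S S' : Set Z} (h : Sm p q S') (hs : S ⊆ S') :
    Sm p q S := by
  obtain ⟨T, h1, h2⟩ := h
  exact ⟨T, h1, hs.trans h2⟩

theorem Sm.iUnion {p : Z → X} {q : Z → Y} {ι : Type*} [Countable ι] {S : ι → Set Z}
    (h : ∀ n, Sm p q (S n)) : Sm p q (⋃ n, S n) := by
  choose T h1 h2 using h
  cases isEmpty_or_nonempty ι
  · refine ⟨fun _ => ∅, fun n z hz => absurd hz (by simp), by simp⟩
  obtain ⟨f, hf⟩ := exists_surjective_nat ι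
  refine ⟨fun n => T (f n.unpair.1) n.unpair.2, fun n => h1 _ _, ?_⟩
  intro z hz
  obtain ⟨i, hi⟩ := mem_iUnion.1 hz
  obtain ⟨m, hm⟩ := mem_iUnion.1 (h2 i hi)
  obtain ⟨n, rfl⟩ := hf i
  refine mem_iUnion.2 ⟨Nat.pair n m, ?_⟩
  simpa using hm

theorem Sm.union {p : Z → X} {q : Z → Y} {S S' : Set Z} (h : Sm p q S) (h' : Sm p q S') :
    Sm p q (S ∪ S') := by
  rw [union_eq_iUnion]
  exact Sm.iUnion (fun b => by cases b <;> simpa)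

theorem Sm.ofCts {p : Z → X} {q : Z → Y} {S : Set Z} (h : CtsOnSet p q S) : Sm p q S :=
  ⟨fun _ => S, fun _ => h, fun z hz => mem_iUnion.2 ⟨0, hz⟩⟩

theorem Sm.empty {p : Z → X} {q : Z → Y} : Sm p q (∅ : Set Z) :=
  Sm.ofCts (fun z hz => absurd hz (by simp))

theorem Sm.nonempty {p : Z → X} {q : Z → Y} {S : Set Z} (h : ¬ Sm p q S) : S.Nonempty := by
  by_contra hne
  rw [not_nonempty_iff_eq_empty] at hne
  exact h (hne ▸ Sm.empty)

theorem Sm.infinite_image {p : Z → X} {q : Z → Y} {S : Set Z} (h : ¬ Sm p q S) :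
    (q '' S).Infinite := by
  intro hf
  apply h
  have := hf.to_subtype
  refine Sm.mono (Sm.iUnion (S := fun y : q '' S => {z | q z = y}) ?_) ?_
  · intro y
    apply Sm.ofCts
    intro z hz O hO
    refine ⟨univ, Filter.univ_mem, fun z' hz' _ => ?_⟩
    have : q z' = q z := by rw [hz, hz']
    rw [this]; exact mem_of_mem_nhds hO
  · intro z hz
    exact mem_iUnion.2 ⟨⟨q z, z, hz, rfl⟩, rfl⟩

/-- essential closure with respect to a map `g` -/
def ecl {T : Type*} [TopologicalSpace T] (p : Z → X) (q : Z → Y) (g : Z → T) (S : Set Z) : Set Z :=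
  {z | ∀ Q ∈ 𝓝 (g z), ¬ Sm p q (S ∩ g ⁻¹' Q)}

theorem ecl_diff {T : Type*} [TopologicalSpace T] [SecondCountableTopology T]
    (p : Z → X) (q : Z → Y) (g : Z → T) (S : Set Z) : Sm p q (S \ ecl p q g S) := by
  let B := TopologicalSpace.countableBasis T
  have hB := TopologicalSpace.isBasis_countableBasis T
  have : Countable {b : B // Sm p q (S ∩ g ⁻¹' (b : Set T))} := inferInstance
  refine Sm.mono (Sm.iUnion
    (S := fun b : {b : B // Sm p q (S ∩ g ⁻¹' (b : Set T))} => S ∩ g ⁻¹' (b.1 : Set T))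
    (fun b => b.2)) ?_
  rintro z ⟨hz, hz'⟩
  simp only [ecl, mem_setOf_eq, not_forall, not_not] at hz'
  obtain ⟨Q, hQ, hs⟩ := hz'
  obtain ⟨b, hb, hzb, hbQ⟩ := hB.mem_nhds_iff.1 hQ
  refine mem_iUnion.2 ⟨⟨⟨b, hb⟩, hs.mono ?_⟩, hz, hzb⟩
  gcongr

theorem ecl_inter_not {T : Type*} [TopologicalSpace T] [SecondCountableTopology T]
    {p : Z → X} {q : Z → Y} (g : Z → T) {S : Set Z} (h : ¬ Sm p q S) :
    ¬ Sm p q (S ∩ ecl p q g S) := by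
  intro h'
  apply h
  have := h'.union (ecl_diff p q g S)
  rwa [inter_union_diff] at this

theorem ecl_mono {T : Type*} [TopologicalSpace T]
    {p : Z → X} {q : Z → Y} {g : Z → T} {S S' : Set Z} (h : S ⊆ S') :
    ecl p q g S ⊆ ecl p q g S' := by
  intro z hz Q hQ hs
  exact hz Q hQ (hs.mono (by gcongr))

theorem ecl_union {T : Type*} [TopologicalSpace T]
    {p : Z → X} {q : Z → Y} {g : Z → T} {S S' : Set Z} :
    ecl p q g (S ∪ S') ⊆ ecl p q g S ∪ ecl p q g S' := by
  intro z hz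
  by_contra hn
  simp only [ecl, mem_union, mem_setOf_eq, not_or, not_forall, not_not] at hn
  obtain ⟨⟨Q, hQ, h1⟩, Q', hQ', h2⟩ := hn
  refine hz (Q ∩ Q') (Filter.inter_mem hQ hQ') ((h1.union h2).mono ?_)
  rintro w ⟨hw | hw, hw1, hw2⟩
  · exact Or.inl ⟨hw, hw1⟩
  · exact Or.inr ⟨hw, hw2⟩

/-- `ecl` is `g`-closed. -/
theorem ecl_closed {T : Type*} [TopologicalSpace T]
    {p : Z → X} {q : Z → Y} {g : Z → T} {S : Set Z} {z : Z}
    (h : ∀ Q ∈ 𝓝 (g z), ∃ w ∈ ecl p q g S, g w ∈ Q) : z ∈ ecl p q g S := by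
  intro Q hQ hs
  obtain ⟨w, hw, hwQ⟩ := h (interior Q) (interior_mem_nhds.2 hQ)
  exact hw (interior Q) (isOpen_interior.mem_nhds hwQ) (hs.mono (by gcongr; exact interior_subset))

theorem fresh1 [SecondCountableTopology X] [SecondCountableTopology Y]
    {p : Z → X} {q : Z → Y} {V : Set Z} (h : ¬ Sm p q V) :
    ∃ b : Set Y, IsOpen b ∧ ¬ Sm p q (V ∩ q ⁻¹' b ∩ ecl p q p (V \ q ⁻¹' closure b)) := by
  by_contra hcon
  push Not at hcon
  apply h
  let B := TopologicalSpace.countableBasis Y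
  have hB := TopologicalSpace.isBasis_countableBasis Y
  let E : Set Z := (⋃ b : B, (V ∩ q ⁻¹' b ∩ ecl p q p (V \ q ⁻¹' closure (b : Set Y)))) ∪
    ⋃ b : B, ((V \ q ⁻¹' closure (b : Set Y)) \ ecl p q p (V \ q ⁻¹' closure (b : Set Y)))
  have hE : Sm p q E := Sm.union
    (Sm.iUnion fun b => hcon b (TopologicalSpace.isOpen_of_mem_countableBasis b.2))
    (Sm.iUnion fun b => ecl_diff _ _ _ _)
  refine Sm.mono (hE.union (Sm.ofCts (S := V \ E) ?_)) (by simp)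
  rintro z ⟨hz, hzE⟩ O hO
  by_contra hno
  push Not at hno
  obtain ⟨F, hF, hFc, hFO⟩ := exists_mem_nhds_isClosed_subset hO
  obtain ⟨b, hb, hzb, hbF⟩ := hB.mem_nhds_iff.1 hF
  have hbO : closure b ⊆ O := (closure_minimal hbF hFc).trans hFO
  apply hzE
  left
  refine mem_iUnion.2 ⟨⟨b, hb⟩, ⟨hz, hzb⟩, ?_⟩
  apply ecl_closed
  intro Q hQ
  obtain ⟨w, ⟨hw, hwE⟩, hwQ, hwO⟩ := hno Q hQ
  refine ⟨w, ?_, hwQ⟩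
  by_contra hwe
  exact hwE (Or.inr (mem_iUnion.2 ⟨⟨b, hb⟩, ⟨hw, fun hc => hwO (hbO hc)⟩, hwe⟩))

/-- closed small neighbourhoods -/
theorem small_nhd {z : Z} {G : Set Z} (hG : G ∈ 𝓝 z) {ε : ℝ} (hε : 0 < ε) :
    ∃ C : Set Z, IsClosed C ∧ C ∈ 𝓝 z ∧ C ⊆ G ∧ ∀ a ∈ C, ∀ b ∈ C, dist a b ≤ ε := by
  obtain ⟨δ, hδ, hs⟩ := Metric.nhds_basis_closedBall.mem_iff.1 hG
  refine ⟨closedBall z (min δ (ε/2)), isClosed_closedBall, closedBall_mem_nhds _ (by positivity),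
    (closedBall_subset_closedBall (min_le_left _ _)).trans hs, ?_⟩
  intro a ha b hb
  have h1 : dist a z ≤ ε/2 := (mem_closedBall.1 ha).trans (min_le_right _ _)
  have h2 : dist b z ≤ ε/2 := (mem_closedBall.1 hb).trans (min_le_right _ _)
  linarith [dist_triangle_right a b z]

theorem fresh2 [SecondCountableTopology Z] [SecondCountableTopology X] [SecondCountableTopology Y]
    {p : Z → X} {q : Z → Y} (hq : Continuous q) {V : Set Z} (h : ¬ Sm p q V)
    {ε : ℝ} (hε : 0 < ε) :
    ∃ (C : Set Z) (D : Set Y), IsClosed C ∧ (∀ a ∈ C, ∀ b ∈ C, dist a b ≤ ε) ∧ IsClosed D ∧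
      q '' C ⊆ interior D ∧ ¬ Sm p q (V ∩ C ∩ ecl p q p (V \ q ⁻¹' D)) := by
  obtain ⟨b, hb, hV⟩ := fresh1 h
  obtain ⟨z, hz, hz'⟩ := Sm.nonempty (ecl_inter_not (id : Z → Z) hV)
  obtain ⟨C, hC, hCz, hCG, hCd⟩ := small_nhd ((hb.preimage hq).mem_nhds hz.1.2) hε
  refine ⟨C, closure b, hC, hCd, isClosed_closure, ?_, ?_⟩
  · rw [image_subset_iff]
    exact hCG.trans (preimage_mono (interior_maximal subset_closure hb))
  · intro hs
    refine hz' C hCz (hs.mono ?_)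
    rintro w ⟨⟨⟨h1, h2⟩, h3⟩, h4⟩
    exact ⟨⟨h1, h4⟩, h3⟩

/-- the canonical flag -/
def VV (p : Z → X) (q : Z → Y) (C : ℕ → Set Z) (N : ℕ → Set Y) (s : ℕ → ℕ) : ℕ → Set Z
  | 0 => univ
  | j + 1 => VV p q C N s j ∩ C j ∩
      {z | s j = 0 → z ∈ ecl p q p (VV p q C N s j \ q ⁻¹' (N j))}

theorem VV_anti {p : Z → X} {q : Z → Y} {C : ℕ → Set Z} {N : ℕ → Set Y} {s : ℕ → ℕ} {i j : ℕ}
    (h : i ≤ j) : VV p q C N s j ⊆ VV p q C N s i := by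
  induction j, h using Nat.le_induction with
  | base => exact Subset.rfl
  | succ j _ ih => exact fun z hz => ih hz.1.1

theorem VV_sub_C {p : Z → X} {q : Z → Y} {C : ℕ → Set Z} {N : ℕ → Set Y} {s : ℕ → ℕ} {i j : ℕ}
    (h : i < j) : VV p q C N s j ⊆ C i :=
  fun _ hz => (VV_anti (Nat.succ_le_of_lt h) hz).1.2

theorem VV_sub_ecl {p : Z → X} {q : Z → Y} {C : ℕ → Set Z} {N : ℕ → Set Y} {s : ℕ → ℕ} {i j : ℕ}
    (h : i < j) (hs : s i = 0) :
    VV p q C N s j ⊆ ecl p q p (VV p q C N s i \ q ⁻¹' (N i)) :=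
  fun _ hz => (VV_anti (Nat.succ_le_of_lt h) hz).2 hs

/-- monotonicity -/
theorem VV_mono {p : Z → X} {q : Z → Y} {C C' : ℕ → Set Z} {N N' : ℕ → Set Y} {s s' : ℕ → ℕ}
    {m : ℕ} (hC : ∀ j < m, C j = C' j) (hs : ∀ j < m, s' j = 0 → s j = 0)
    (hN : ∀ j < m, s' j = 0 → ∀ z ∈ VV p q C N s j, q z ∈ N' j → q z ∈ N j) :
    VV p q C N s m ⊆ VV p q C' N' s' m := by
  induction m with
  | zero => exact Subset.rfl
  | succ m ih =>
    have ih' := ih (fun j hj => hC j (by omega)) (fun j hj => hs j (by omega))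
      (fun j hj => hN j (by omega))
    rintro z ⟨⟨h1, h2⟩, h3⟩
    refine ⟨⟨ih' h1, hC m (by omega) ▸ h2⟩, fun h0 => ?_⟩
    refine ecl_mono ?_ (h3 (hs m (by omega) h0))
    rintro w ⟨hw, hwN⟩
    exact ⟨ih' hw, fun hc => hwN (hN m (by omega) h0 w hw hc)⟩

/-- partition lemma -/
theorem VV_part {p : Z → X} {q : Z → Y} {C : ℕ → Set Z} {N N1 N2 : ℕ → Set Y} {s : ℕ → ℕ}
    {i : ℕ} (h1 : ∀ j, j ≠ i → N1 j = N j) (h2 : ∀ j, j ≠ i → N2 j = N j)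
    (hi : N1 i ∩ N2 i ⊆ N i) (hi1 : N i ⊆ N1 i) (hi2 : N i ⊆ N2 i) (m : ℕ) :
    VV p q C N s m ⊆ VV p q C N1 s m ∪ VV p q C N2 s m ∧
    (∀ z ∈ VV p q C N s m, (∀ Q ∈ 𝓝 (p z), ∃ w ∈ VV p q C N1 s m, p w ∈ Q) →
      z ∈ VV p q C N1 s m) ∧
    (∀ z ∈ VV p q C N s m, (∀ Q ∈ 𝓝 (p z), ∃ w ∈ VV p q C N2 s m, p w ∈ Q) →
      z ∈ VV p q C N2 s m) := by
  induction m with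
  | zero => simp [VV]
  | succ m ih =>
    obtain ⟨ih0, ih1, ih2⟩ := ih
    have key : ∀ N' : ℕ → Set Y, 
        (∀ z ∈ VV p q C N s m, (∀ Q ∈ 𝓝 (p z), ∃ w ∈ VV p q C N' s m, p w ∈ Q) →
          z ∈ VV p q C N' s m) →
        ∀ z ∈ VV p q C N s (m+1), (∀ Q ∈ 𝓝 (p z), ∃ w ∈ VV p q C N' s (m+1), p w ∈ Q) →
          z ∈ VV p q C N' s (m+1) := by
      intro N' hN' z hz hQ
      refine ⟨⟨hN' z hz.1.1 fun Q h => ?_, hz.1.2⟩, fun h0 => ecl_closed fun Q h => ?_⟩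
      · obtain ⟨w, hw, hwQ⟩ := hQ Q h
        exact ⟨w, hw.1.1, hwQ⟩
      · obtain ⟨w, hw, hwQ⟩ := hQ Q h
        exact ⟨w, hw.2 h0, hwQ⟩
    refine ⟨?_, key N1 ih1, key N2 ih2⟩
    intro z hz
    by_cases h0 : s m = 0
    · have hz' := hz.2 h0
      have hsub : VV p q C N s m \ q ⁻¹' N m ⊆
          (VV p q C N1 s m \ q ⁻¹' N1 m) ∪ (VV p q C N2 s m \ q ⁻¹' N2 m) := by
        rintro w ⟨hw, hwN⟩
        by_cases hmi : m = i
        · subst hmi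
          have e1 : VV p q C N s m ⊆ VV p q C N1 s m :=
            VV_mono (fun _ _ => rfl) (fun _ _ h => h)
              (fun j hj _ z _ hz => by rwa [h1 j (by omega)] at hz)
          have e2 : VV p q C N s m ⊆ VV p q C N2 s m :=
            VV_mono (fun _ _ => rfl) (fun _ _ h => h)
              (fun j hj _ z _ hz => by rwa [h2 j (by omega)] at hz)
          by_cases hc : q w ∈ N1 m
          · right
            exact ⟨e2 hw, fun hc2 => hwN (hi ⟨hc, hc2⟩)⟩
          · left
            exact ⟨e1 hw, hc⟩
        · rcases ih0 hw with hw' | hw'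
          · left; exact ⟨hw', by rw [h1 m hmi]; exact hwN⟩
          · right; exact ⟨hw', by rw [h2 m hmi]; exact hwN⟩
      have fin : ∀ N' : ℕ → Set Y, 
          (∀ z ∈ VV p q C N s m, (∀ Q ∈ 𝓝 (p z), ∃ w ∈ VV p q C N' s m, p w ∈ Q) →
            z ∈ VV p q C N' s m) → z ∈ ecl p q p (VV p q C N' s m \ q ⁻¹' N' m) →
            z ∈ VV p q C N' s (m+1) := by
        intro N' hN' he
        refine ⟨⟨hN' z hz.1.1 fun Q hQ => ?_, hz.1.2⟩, fun _ => he⟩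
        obtain ⟨w, hw⟩ := Sm.nonempty (he Q hQ)
        exact ⟨w, hw.1.1, hw.2⟩
      rcases ecl_union (ecl_mono hsub hz') with h | h
      · left; exact fin N1 ih1 h
      · right; exact fin N2 ih2 h
    · rcases ih0 hz.1.1 with h | h
      · left; exact ⟨⟨h, hz.1.2⟩, fun h' => absurd h' h0⟩
      · right; exact ⟨⟨h, hz.1.2⟩, fun h' => absurd h' h0⟩


def II (n : ℕ → ℕ) : Set (ℕ → ℕ) := {s | ∀ i, s i < n i}

def NN (n : ℕ → ℕ) (D : (ℕ → ℕ) → ℕ → Set Y) (s : ℕ → ℕ) (j : ℕ) : Set Y :=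
  {y | ∃ s' ∈ II n, (∀ l < j, s' l = s l) ∧ y ∈ D s' j}

theorem II_finite {n : ℕ → ℕ} {L : ℕ} (h : ∀ i, L ≤ i → n i = 1) : (II n).Finite := by
  have hf : {g : Fin L → ℕ | ∀ i : Fin L, g i ∈ Iio (n i)}.Finite := 
    Set.Finite.pi' (fun i => finite_Iio _)
  refine Set.Finite.of_finite_image (f := fun s (i : Fin L) => s i) (hf.subset ?_) ?_
  · rintro _ ⟨s, hs, rfl⟩ i
    exact hs i
  · intro s hs s' hs' he
    funext i
    by_cases hi : i < L
    · exact congrFun he ⟨i, hi⟩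
    · have h1 := hs i
      have h2 := hs' i
      rw [h i (by omega)] at h1 h2
      omega

structure Good (p : Z → X) (q : Z → Y) (L : ℕ) (n : ℕ → ℕ) (C : (ℕ → ℕ) → ℕ → Set Z)
    (D : (ℕ → ℕ) → ℕ → Set Y) (u : (ℕ → ℕ) → Z) : Prop where
  n1 : ∀ i, L ≤ i → n i = 1
  npos : ∀ i, 0 < n i
  Ccl : ∀ s ∈ II n, ∀ j < L, IsClosed (C s j)
  Cd : ∀ s ∈ II n, ∀ j < L, ∀ a ∈ C s j, ∀ b ∈ C s j, dist a b ≤ (1/2 : ℝ)^j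
  Dcl : ∀ s ∈ II n, ∀ j < L, IsClosed (D s j)
  CD : ∀ s ∈ II n, ∀ j < L, q '' (C s j) ⊆ interior (D s j)
  disj : ∀ s ∈ II n, ∀ s' ∈ II n, ∀ j < L, (∀ l < j, s l = s' l) → s j ≠ s' j →
    Disjoint (D s j) (D s' j)
  hu : ∀ s ∈ II n, u s ∈ VV p q (C s) (NN n D s) s L ∩ ecl p q p (VV p q (C s) (NN n D s) s L)

theorem pick_u [SecondCountableTopology X] {p : Z → X} {q : Z → Y} {V : Set Z} {G : Set Z}
    (h : ¬ Sm p q (V ∩ G)) : ∃ u, u ∈ V ∩ ecl p q p V ∧ u ∈ G := by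
  obtain ⟨u, hu, hu'⟩ := Sm.nonempty (ecl_inter_not p h)
  exact ⟨u, ⟨hu.1, ecl_mono inter_subset_left hu'⟩, hu.2⟩

theorem stepA [SecondCountableTopology Z] [SecondCountableTopology X] [SecondCountableTopology Y]
    {p : Z → X} {q : Z → Y} (hq : Continuous q) {L : ℕ} {n : ℕ → ℕ} {C : (ℕ → ℕ) → ℕ → Set Z}
    {D : (ℕ → ℕ) → ℕ → Set Y} {u : (ℕ → ℕ) → Z} (g : Good p q L n C D u)
    {ε : ℝ} (hε : 0 < ε) :
    ∃ C' D' u', Good p q (L+1) n C' D' u' ∧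
      (∀ s ∈ II n, ∀ j < L, C' s j = C s j ∧ D' s j = D s j) ∧
      ∀ s ∈ II n, dist (p (u' s)) (p (u s)) < ε := by
  have key : ∀ s, s ∈ II n → ∃ (c : Set Z) (d : Set Y), IsClosed c ∧
      (∀ a ∈ c, ∀ b ∈ c, dist a b ≤ (1/2 : ℝ)^L) ∧ IsClosed d ∧ q '' c ⊆ interior d ∧
      ¬ Sm p q ((VV p q (C s) (NN n D s) s L ∩ p ⁻¹' ball (p (u s)) ε) ∩ c ∩
        ecl p q p ((VV p q (C s) (NN n D s) s L ∩ p ⁻¹' ball (p (u s)) ε) \ q ⁻¹' d)) := by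
    intro s hs
    exact fresh2 hq ((g.hu s hs).2 _ (ball_mem_nhds _ hε)) (by positivity)
  choose! c d hc hcd hd hcd2 hns using key
  let C' : (ℕ → ℕ) → ℕ → Set Z := fun s j => if j = L then c s else C s j
  let D' : (ℕ → ℕ) → ℕ → Set Y := fun s j => if j = L then d s else D s j
  have eqs : ∀ s ∈ II n, ∀ s' ∈ II n, (∀ l < L, s' l = s l) → s' = s := by
    intro s hs s' hs' h
    funext l
    by_cases hl : l < L
    · exact h l hl
    · have h1 := hs l
      have h2 := hs' l
      rw [g.n1 l (by omega)] at h1 h2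
      omega
  have hV : ∀ s ∈ II n, VV p q (C s) (NN n D s) s L ⊆ VV p q (C' s) (NN n D' s) s L := by
    intro s hs
    refine VV_mono (fun j hj => by simp [C', hj.ne]) (fun _ _ h => h) ?_
    rintro j hj h0 z hz ⟨s', hs', h1, h2⟩
    exact ⟨s', hs', h1, by simpa [D', hj.ne] using h2⟩
  have hV2 : ∀ s ∈ II n, ¬ Sm p q (VV p q (C' s) (NN n D' s) s (L+1) ∩
      p ⁻¹' ball (p (u s)) ε) := by
    intro s hs hsm
    refine hns s hs (hsm.mono ?_)
    rintro z ⟨⟨⟨h1, h1'⟩, h2⟩, h3⟩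
    refine ⟨⟨⟨hV s hs h1, by simpa [C'] using h2⟩, fun _ => ecl_mono ?_ h3⟩, h1'⟩
    rintro w ⟨hw, hwd⟩
    refine ⟨hV s hs hw.1, ?_⟩
    rintro ⟨s', hs', h4, h5⟩
    rw [eqs s hs s' hs' h4] at h5
    exact hwd (by simpa [D'] using h5)
  have hu' : ∀ s, s ∈ II n → ∃ v, v ∈ VV p q (C' s) (NN n D' s) s (L+1) ∩
      ecl p q p (VV p q (C' s) (NN n D' s) s (L+1)) ∧ v ∈ p ⁻¹' ball (p (u s)) ε := 
    fun s hs => pick_u (hV2 s hs)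
  have : Nonempty Z := ⟨u 0⟩
  choose! u' hu1 hu2 using hu'
  refine ⟨C', D', u', ⟨fun i hi => g.n1 i (by omega), g.npos, ?_, ?_, ?_, ?_, ?_, hu1⟩, ?_, hu2⟩
  · intro s hs j hj
    by_cases h : j = L
    · simpa [C', h] using hc s hs
    · simpa [C', h] using g.Ccl s hs j (by omega)
  · intro s hs j hj
    by_cases h : j = L
    · simpa [C', h] using hcd s hs
    · simpa [C', h] using g.Cd s hs j (by omega)
  · intro s hs j hj
    by_cases h : j = L
    · simpa [D', h] using hd s hs
    · simpa [D', h] using g.Dcl s hs j (by omega)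
  · intro s hs j hj
    by_cases h : j = L
    · simpa [C', D', h] using hcd2 s hs
    · simpa [C', D', h] using g.CD s hs j (by omega)
  · intro s hs s' hs' j hj h1 h2
    by_cases h : j = L
    · subst h
      exact absurd (congrFun (eqs s' hs' s hs h1) j) h2
    · simpa [D', h] using g.disj s hs s' hs' j (by omega) h1 h2
  · intro s hs j hj
    simp [C', D', hj.ne]

theorem flagB [SecondCountableTopology Z] [SecondCountableTopology X] [SecondCountableTopology Y]
    {p : Z → X} {q : Z → Y} (hq : Continuous q) {i : ℕ} {C0 : ℕ → Set Z} {N0 : ℕ → Set Y}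
    {s : ℕ → ℕ} (hs : s i ≠ 0) {Ci : Set Z} {Di : Set Y} (hCi : IsClosed Ci) (hDi : IsClosed Di)
    (hCD : q '' Ci ⊆ interior Di)
    (hns : ¬ Sm p q (VV p q C0 N0 s i ∩ Ci)) (m : ℕ) (hm : i + 1 ≤ m) :
    ∃ (C' : ℕ → Set Z) (D' : ℕ → Set Y), (∀ j < i, C' j = C0 j) ∧ C' i = Ci ∧ D' i = Di ∧
      (∀ j, i < j → j < m → IsClosed (C' j) ∧ (∀ a ∈ C' j, ∀ b ∈ C' j, dist a b ≤ (1/2 : ℝ)^j) ∧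
        IsClosed (D' j) ∧ q '' C' j ⊆ interior (D' j) ∧ D' j ⊆ Di) ∧
      ¬ Sm p q (VV p q C' (fun j => if j < i then N0 j else D' j) s m) := by
  induction m, hm using Nat.le_induction with
  | base =>
    refine ⟨fun j => if j = i then Ci else C0 j, fun _ => Di, ?_, by simp, rfl, ?_, ?_⟩
    · intro j hj; simp [hj.ne]
    · intro j h1 h2; omega
    · intro h
      refine hns (h.mono ?_)
      rintro z ⟨h1, h2⟩
      refine ⟨⟨?_, by simpa using h2⟩, fun h => absurd h hs⟩
      refine VV_mono (fun j hj => by simp [hj.ne]) (fun _ _ h => h) ?_ h1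
      intro j hj h0 z hz hz'
      simpa [hj] using hz'
  | succ m hm ih =>
    obtain ⟨C1, D1, h1, h2, h3, h4, h5⟩ := ih
    obtain ⟨c, d, hc, hcd, hd, hcd2, hn⟩ := fresh2 hq h5 (ε := (1/2 : ℝ)^m) (by positivity)
    refine ⟨fun j => if j = m then c ∩ Ci else C1 j, fun j => if j = m then d ∩ Di else D1 j,
      ?_, ?_, ?_, ?_, ?_⟩
    · intro j hj
      have : j ≠ m := by omega
      simp [this, h1 j hj]
    · have : i ≠ m := by omega
      simp [this, h2]
    · have : i ≠ m := by omega
      simp [this, h3]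
    · intro j hij hjm
      by_cases h : j = m
      · subst h
        simp only [if_true]
        refine ⟨hc.inter hCi, fun a ha b hb => hcd a ha.1 b hb.1, hd.inter hDi, ?_,
          inter_subset_right⟩
        rw [interior_inter]
        rintro _ ⟨z, hz, rfl⟩
        exact ⟨hcd2 ⟨z, hz.1, rfl⟩, hCD ⟨z, hz.2, rfl⟩⟩
      · simpa [h] using h4 j hij (by omega)
    · intro hsm
      refine hn (hsm.mono ?_)
      have hV : VV p q C1 (fun j => if j < i then N0 j else D1 j) s m ⊆
          VV p q (fun j => if j = m then c ∩ Ci else C1 j)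
            (fun j => if j < i then N0 j else if j = m then d ∩ Di else D1 j) s m := by
        refine VV_mono (fun j hj => by simp [hj.ne]) (fun _ _ h => h) ?_
        intro j hj h0 z hz hz'
        simpa [hj.ne] using hz'
      have hCi' : VV p q C1 (fun j => if j < i then N0 j else D1 j) s m ⊆ Ci := by
        rw [← h2]
        exact VV_sub_C (by omega)
      rintro z ⟨⟨hz1, hz2⟩, hz3⟩
      refine ⟨⟨hV hz1, ?_⟩, fun _ => ecl_mono ?_ hz3⟩
      · simp only [if_true]
        exact ⟨hz2, hCi' hz1⟩
      · rintro w ⟨hw1, hw2⟩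
        refine ⟨hV hw1, fun hc => hw2 ?_⟩
        have : ¬ m < i := by omega
        simp only [mem_preimage, this, if_false, if_true] at hc
        exact hc.1


theorem pick_distinct {κ W : Type*} [Finite κ] {T : κ → Set W} (h : ∀ k, (T k).Infinite) :
    ∃ f : κ → W, Function.Injective f ∧ ∀ k, f k ∈ T k := by
  classical
  have := Fintype.ofFinite κ
  have key : ∀ F : Finset κ, ∃ f : κ → W, InjOn f F ∧ ∀ k, f k ∈ T k := by
    intro F
    induction F using Finset.induction_on with
    | empty =>
      choose f hf using fun k => (h k).nonempty
      exact ⟨f, by simp, hf⟩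
    | insert a F ha ih =>
      obtain ⟨f, h1, h2⟩ := ih
      obtain ⟨y, hy, hy'⟩ := ((h a).diff (F.finite_toSet.image f)).nonempty
      have hu : ∀ k ∈ F, Function.update f a y k = f k := by
        intro k hk
        rw [Function.update_of_ne]
        rintro rfl; exact ha hk
      refine ⟨Function.update f a y, ?_, ?_⟩
      · rw [Finset.coe_insert, injOn_insert (by simpa using ha)]
        constructor
        · intro k hk k' hk' he
          rw [hu k hk, hu k' hk'] at he
          exact h1 hk hk' he
        · rintro ⟨k, hk, he⟩
          rw [hu k hk, Function.update_self] at he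
          exact hy' ⟨k, hk, he⟩
      · intro k
        by_cases hk : k = a
        · subst hk; simpa using hy
        · simpa [hk] using h2 k
  obtain ⟨f, h1, h2⟩ := key Finset.univ
  exact ⟨f, by simpa [injOn_univ] using h1, h2⟩

theorem separate {κ : Type*} [Finite κ] {y : κ → Y} (hy : Function.Injective y) {M : κ → Set Y}
    (hM : ∀ k, IsClosed (M k)) (hyM : ∀ k, y k ∉ M k) :
    ∃ D : κ → Set Y, (∀ k, IsClosed (D k)) ∧ (∀ k, D k ∈ 𝓝 (y k)) ∧
      (∀ k, Disjoint (D k) (M k)) ∧ ∀ k k', k ≠ k' → Disjoint (D k) (D k') := by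
  obtain ⟨U, hU, hd⟩ := (finite_range y).t2_separation
  have key : ∀ k, ∃ D, D ∈ 𝓝 (y k) ∧ IsClosed D ∧ D ⊆ U (y k) ∩ (M k)ᶜ := fun k =>
    exists_mem_nhds_isClosed_subset (Filter.inter_mem ((hU _).2.mem_nhds (hU _).1)
      ((hM k).isOpen_compl.mem_nhds (hyM k)))
  choose D h1 h2 h3 using key
  refine ⟨D, h2, h1, fun k => ?_, fun k k' hk => ?_⟩
  · exact (disjoint_compl_left (a := M k)).mono_left ((h3 k).trans inter_subset_right)
  · exact (hd ⟨k, rfl⟩ ⟨k', rfl⟩ (hy.ne hk)).mono ((h3 k).trans inter_subset_left)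
      ((h3 k').trans inter_subset_left)

theorem NN_closed {p : Z → X} {q : Z → Y} {L : ℕ} {n : ℕ → ℕ} {C : (ℕ → ℕ) → ℕ → Set Z}
    {D : (ℕ → ℕ) → ℕ → Set Y} {u : (ℕ → ℕ) → Z} (g : Good p q L n C D u) (s : ℕ → ℕ)
    {j : ℕ} (hj : j < L) : IsClosed (NN n D s j) := by
  have : NN n D s j = ⋃ s' ∈ {s' | s' ∈ II n ∧ ∀ l < j, s' l = s l}, D s' j := by
    ext y; simp [NN, and_assoc]
  rw [this]
  refine Set.Finite.isClosed_biUnion ((II_finite g.n1).subset fun s h => h.1) ?_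
  intro s' hs'
  exact g.Dcl s' hs'.1 j hj


theorem stepB1 [SecondCountableTopology Z] [SecondCountableTopology X] [SecondCountableTopology Y]
    {p : Z → X} {q : Z → Y} (hp : Continuous p) (hq : Continuous q)
    {L : ℕ} {n : ℕ → ℕ} {C : (ℕ → ℕ) → ℕ → Set Z}
    {D : (ℕ → ℕ) → ℕ → Set Y} {u : (ℕ → ℕ) → Z} (g : Good p q L n C D u)
    {i : ℕ} (hi : i < L) {ε : ℝ} (hε : 0 < ε) :
    ∃ (Cs : (ℕ → ℕ) → Set Z) (Ds : (ℕ → ℕ) → Set Y),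
      (∀ s ∈ II n, s i = 0 → IsClosed (Cs s) ∧
        (∀ a ∈ Cs s, ∀ b ∈ Cs s, dist a b ≤ (1/2 : ℝ)^i) ∧
        IsClosed (Ds s) ∧ q '' (Cs s) ⊆ interior (Ds s) ∧
        Cs s ⊆ p ⁻¹' ball (p (u s)) ε ∧
        Disjoint (Ds s) (NN n D s i) ∧
        ¬ Sm p q (VV p q (C s) (NN n D s) s i ∩ Cs s)) ∧
      (∀ s ∈ II n, s i = 0 → ∀ s' ∈ II n, s' i = 0 → s ≠ s' → Disjoint (Ds s) (Ds s')) ∧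
      ∀ s ∈ II n, ¬ Sm p q (VV p q (C s) (fun j => NN n D s j ∪ {y | j = i ∧
        ∃ s' ∈ II n, s' i = 0 ∧ (∀ l < i, s' l = s l) ∧ y ∈ Ds s'}) s L ∩
          p ⁻¹' ball (p (u s)) ε) := by
  classical
  have hfin := II_finite g.n1
  have : Finite (II n) := hfin.to_subtype
  let J := {s : ℕ → ℕ // s ∈ II n ∧ s i = 0}
  have : Finite J := (hfin.subset (fun s (h : s ∈ II n ∧ s i = 0) => h.1)).to_subtype
  let R := Nat.card (II n) + 1
  let S : J → Set Z := fun s => (VV p q (C s.1) (NN n D s.1) s.1 i \ q ⁻¹' (NN n D s.1 i)) ∩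
    p ⁻¹' ball (p (u s.1)) ε
  have hS : ∀ s : J, ¬ Sm p q (S s) := fun s =>
    VV_sub_ecl hi s.2.2 (g.hu s.1 s.2.1).1 _ (ball_mem_nhds _ hε)
  let K : J → Set Z := fun s => S s ∩ ecl p q (id : Z → Z) (S s)
  have hK : ∀ s : J, ¬ Sm p q (K s) := fun s => ecl_inter_not id (hS s)
  obtain ⟨y, hyinj, hyK⟩ := pick_distinct (κ := J × Fin R) (T := fun k => q '' K k.1)
    (fun k => Sm.infinite_image (hK k.1))
  choose z hzK hzy using hyK
  obtain ⟨E, hEc, hEn, hEM, hEd⟩ := separate hyinj (M := fun k : J × Fin R => NN n D k.1.1 i)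
    (fun k => NN_closed g _ hi) (fun k => by rw [← hzy k]; exact (hzK k).1.1.2)
  have key : ∀ k : J × Fin R, ∃ c : Set Z, IsClosed c ∧ c ∈ 𝓝 (z k) ∧
      c ⊆ q ⁻¹' interior (E k) ∩ p ⁻¹' ball (p (u k.1.1)) ε ∧
      ∀ a ∈ c, ∀ b ∈ c, dist a b ≤ (1/2 : ℝ)^i := by
    intro k
    refine small_nhd (Filter.inter_mem ?_ ?_) (by positivity)
    · apply hq.continuousAt.preimage_mem_nhds
      rw [hzy k]
      exact interior_mem_nhds.2 (hEn k)
    · exact (isOpen_ball.preimage hp).mem_nhds (hzK k).1.2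
  choose c hcc hcn hcs hcd using key
  -- pigeonhole
  let Nr : Fin R → (ℕ → ℕ) → ℕ → Set Y := fun r s j => NN n D s j ∪ {y | j = i ∧
        ∃ s' : J, (∀ l < i, s'.1 l = s l) ∧ y ∈ E (s', r)}
  have hr : ∃ r : Fin R, ∀ s ∈ II n, ¬ Sm p q (VV p q (C s) (Nr r s) s L ∩
      p ⁻¹' ball (p (u s)) ε) := by
    by_contra hcon
    push Not at hcon
    choose f hf1 hf2 using hcon
    have hinj : Function.Injective (fun r => (⟨f r, hf1 r⟩ : II n)) := by
      intro r r' he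
      by_contra hne
      have he' : f r = f r' := congrArg Subtype.val he
      have h2 := hf2 r'
      rw [← he'] at h2
      have hpart := (VV_part (p := p) (q := q) (C := C (f r)) (N := NN n D (f r))
        (N1 := Nr r (f r)) (N2 := Nr r' (f r)) (s := f r) (i := i)
        (fun j hj => by ext y; simp [Nr, hj]) (fun j hj => by ext y; simp [Nr, hj])
        (by
          rintro y ⟨h1 | ⟨_, s1, _, h1⟩, h2⟩
          · exact h1
          · rcases h2 with h2 | ⟨_, s2, _, h2⟩
            · exact h2
            · exact absurd h2 (disjoint_left.1 (hEd (s1, r) (s2, r') (by simp [hne])) h1))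
        subset_union_left subset_union_left L).1
      refine (g.hu (f r) (hf1 r)).2 _ (ball_mem_nhds _ hε) (((hf2 r).union h2).mono ?_)
      rintro w ⟨hw1, hw2⟩
      rcases hpart hw1 with h | h
      · exact Or.inl ⟨h, hw2⟩
      · exact Or.inr ⟨h, hw2⟩
    have := Nat.card_le_card_of_injective _ hinj
    simp [R] at this
  obtain ⟨r, hr⟩ := hr
  refine ⟨fun s => if h : s ∈ II n ∧ s i = 0 then c (⟨s, h⟩, r) else ∅,
    fun s => if h : s ∈ II n ∧ s i = 0 then E (⟨s, h⟩, r) else ∅, ?_, ?_, ?_⟩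
  · intro s hs h0
    have h : s ∈ II n ∧ s i = 0 := ⟨hs, h0⟩
    simp only [h, and_self, dif_pos]
    refine ⟨hcc _, hcd _, hEc _, ?_, fun w hw => (hcs _ hw).2, hEM (⟨s, h⟩, r), ?_⟩
    · rw [image_subset_iff]
      exact fun w hw => (hcs _ hw).1
    · intro hsm
      refine (hzK (⟨s, h⟩, r)).2 _ (hcn _) (hsm.mono ?_)
      rintro w ⟨hw1, hw2⟩
      exact ⟨hw1.1.1, hw2⟩
  · intro s hs h0 s' hs' h0' hne
    have h : s ∈ II n ∧ s i = 0 := ⟨hs, h0⟩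
    have h' : s' ∈ II n ∧ s' i = 0 := ⟨hs', h0'⟩
    simp only [h, h', and_self, dif_pos]
    exact hEd _ _ (fun he => hne (congrArg (fun k => k.1.1) he))
  · intro s hs hsm
    refine hr s hs (hsm.mono ?_)
    refine inter_subset_inter_left _ (VV_mono (fun _ _ => rfl) (fun _ _ h => h) ?_)
    rintro j hj h0 w hw (h1 | ⟨h1, s', hs', h2, h3, h4⟩)
    · exact Or.inl h1
    · refine Or.inr ⟨h1, ⟨s', hs', h2⟩, h3, ?_⟩
      simpa [hs', h2] using h4

theorem stepB [SecondCountableTopology Z] [SecondCountableTopology X] [SecondCountableTopology Y]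
    {p : Z → X} {q : Z → Y} (hp : Continuous p) (hq : Continuous q)
    {L : ℕ} {n : ℕ → ℕ} {C : (ℕ → ℕ) → ℕ → Set Z}
    {D : (ℕ → ℕ) → ℕ → Set Y} {u : (ℕ → ℕ) → Z} (g : Good p q L n C D u)
    {i : ℕ} (hi : i < L) {ε : ℝ} (hε : 0 < ε) :
    ∃ C' D' u', Good p q L (Function.update n i (n i + 1)) C' D' u' ∧
      (∀ s ∈ II n, ∀ j < L, C' s j = C s j ∧ D' s j = D s j) ∧
      (∀ s ∈ II n, s i = 0 → ∀ j < i, C' (Function.update s i (n i)) j = C s j ∧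
        D' (Function.update s i (n i)) j = D s j) ∧
      (∀ s ∈ II n, dist (p (u' s)) (p (u s)) < ε) ∧
      ∀ s ∈ II n, s i = 0 → dist (p (u' (Function.update s i (n i)))) (p (u s)) < ε := by
  classical
  obtain ⟨Cs, Ds, hCD, hdis, hold⟩ := stepB1 hp hq g hi hε
  have hnp := g.npos i
  have key : ∀ s, s ∈ II n → s i = 0 → ∃ (C' : ℕ → Set Z) (D' : ℕ → Set Y),
      (∀ j < i, C' j = C s j) ∧ C' i = Cs s ∧ D' i = Ds s ∧
      (∀ j, i < j → j < L → IsClosed (C' j) ∧ (∀ a ∈ C' j, ∀ b ∈ C' j, dist a b ≤ (1/2 : ℝ)^j) ∧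
        IsClosed (D' j) ∧ q '' C' j ⊆ interior (D' j) ∧ D' j ⊆ Ds s) ∧
      ¬ Sm p q (VV p q C' (fun j => if j < i then NN n D s j else D' j)
        (Function.update s i (n i)) L) := by
    intro s hs h0
    obtain ⟨h1, h2, h3, h4, h5, h6, h7⟩ := hCD s hs h0
    refine flagB hq (by simp; omega) h1 h3 h4 ?_ L hi
    intro hsm
    refine h7 (hsm.mono (inter_subset_inter_left _ ?_))
    refine VV_mono (fun _ _ => rfl) (fun j hj h => ?_) (fun j hj _ z _ h => h)
    rwa [Function.update_of_ne hj.ne] at h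
  choose! CF DF hF1 hF2 hF3 hF4 hF5 using key
  set n' := Function.update n i (n i + 1) with hn'
  have hn'j : ∀ j, j ≠ i → n' j = n j := fun j hj => by simp [n', hj]
  have hn'i : n' i = n i + 1 := by simp [n']
  have mem_old : ∀ s, s ∈ II n' → s i < n i → s ∈ II n := by
    intro s hs h j
    by_cases hj : j = i
    · rw [hj]; exact h
    · rw [← hn'j j hj]; exact hs j
  have old_mem : ∀ s, s ∈ II n → s ∈ II n' ∧ s i < n i := by
    intro s hs
    refine ⟨fun j => ?_, hs i⟩
    by_cases hj : j = i
    · rw [hj, hn'i]; have := hs i; omega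
    · rw [hn'j j hj]; exact hs j
  have mem_new : ∀ s, s ∈ II n' → ¬ s i < n i → s i = n i ∧ Function.update s i 0 ∈ II n ∧
      s = Function.update (Function.update s i 0) i (n i) := by
    intro s hs h
    have h1 := hs i
    rw [hn'i] at h1
    have h2 : s i = n i := by omega
    refine ⟨h2, fun j => ?_, by simp [← h2]⟩
    by_cases hj : j = i
    · subst hj; simpa using hnp
    · rw [Function.update_of_ne hj, ← hn'j j hj]; exact hs j
  have new_mem : ∀ s, s ∈ II n → s i = 0 → Function.update s i (n i) ∈ II n' := by
    intro s hs h0 j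
    by_cases hj : j = i
    · subst hj; simp [hn'i]
    · rw [Function.update_of_ne hj, hn'j j hj]; exact hs j
  have upd : ∀ s : ℕ → ℕ, s i = 0 → Function.update (Function.update s i (n i)) i 0 = s := by
    intro s h0
    simp [← h0]
  let C' : (ℕ → ℕ) → ℕ → Set Z := fun s => if s i < n i then C s else CF (Function.update s i 0)
  let D' : (ℕ → ℕ) → ℕ → Set Y := fun s => if s i < n i then D s else
    fun j => if j < i then D (Function.update s i 0) j else DF (Function.update s i 0) j
  have C'old : ∀ s, s i < n i → C' s = C s := fun s h => by simp [C', h]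
  have D'old : ∀ s, s i < n i → D' s = D s := fun s h => by simp [D', h]
  have C'new : ∀ s, s i = 0 → C' (Function.update s i (n i)) = CF s := fun s h => by
    simp only [C', Function.update_self, lt_irrefl, if_false, upd s h]
  have D'new : ∀ s, s i = 0 → ∀ j, D' (Function.update s i (n i)) j =
      if j < i then D s j else DF s j := fun s h j => by
    simp only [D', Function.update_self, lt_irrefl, if_false, upd s h]
  -- case analysis
  have cases : ∀ P : (ℕ → ℕ) → Prop, (∀ s ∈ II n, P s) →
      (∀ s ∈ II n, s i = 0 → P (Function.update s i (n i))) → ∀ s ∈ II n', P s := by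
    intro P h1 h2 s hs
    by_cases h : s i < n i
    · exact h1 s (mem_old s hs h)
    · obtain ⟨_, ha, hb⟩ := mem_new s hs h
      rw [hb]
      exact h2 _ ha (by simp)
  have DFsub : ∀ s ∈ II n, s i = 0 → ∀ j, i ≤ j → j < L → DF s j ⊆ Ds s := by
    intro s hs h0 j h1 h2
    rcases h1.eq_or_lt with rfl | h1
    · rw [hF3 s hs h0]
    · exact (hF4 s hs h0 j h1 h2).2.2.2.2
  -- old
  have Vold : ∀ s ∈ II n, ¬ Sm p q (VV p q (C' s) (NN n' D' s) s L ∩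
      p ⁻¹' ball (p (u s)) ε) := by
    intro s hs hsm
    refine hold s hs (hsm.mono (inter_subset_inter_left _ ?_))
    rw [C'old s (hs i)]
    refine VV_mono (fun _ _ => rfl) (fun _ _ h => h) ?_
    rintro j hj h0 z hz ⟨s', hs', hpre, hD⟩
    revert hpre hD
    refine cases (fun s' => (∀ l < j, s' l = s l) → q z ∈ D' s' j → _) ?_ ?_ s' hs'
    · intro s' hs' hpre hD
      rw [D'old s' (hs' i)] at hD
      exact Or.inl ⟨s', hs', hpre, hD⟩
    · intro s' hs' h0' hpre hD
      rw [D'new s' h0'] at hD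
      rcases lt_trichotomy j i with h | h | h
      · rw [if_pos h] at hD
        refine Or.inl ⟨s', hs', fun l hl => ?_, hD⟩
        have := hpre l hl
        rwa [Function.update_of_ne (by omega)] at this
      · rw [if_neg (by omega)] at hD
        refine Or.inr ⟨h, s', hs', h0', fun l hl => ?_, DFsub s' hs' h0' j h.ge hj hD⟩
        have := hpre l (by omega)
        rwa [Function.update_of_ne (by omega)] at this
      · have := hpre i h
        rw [Function.update_self] at this
        have h3 := hs i
        omega
  have Vnew : ∀ s ∈ II n, s i = 0 → ¬ Sm p q (VV p q (C' (Function.update s i (n i)))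
      (NN n' D' (Function.update s i (n i))) (Function.update s i (n i)) L ∩
      p ⁻¹' ball (p (u s)) ε) := by
    intro s hs hs0 hsm
    refine hF5 s hs hs0 (hsm.mono ?_)
    rw [C'new s hs0]
    refine subset_inter (VV_mono (fun _ _ => rfl) (fun _ _ h => h) ?_) ?_
    · rintro j hj h0 z hz ⟨s', hs', hpre, hD⟩
      have hji : j ≠ i := by
        rintro rfl
        rw [Function.update_self] at h0
        omega
      revert hpre hD
      refine cases (fun s' => (∀ l < j, s' l = Function.update s i (n i) l) → q z ∈ D' s' j →
        (q z ∈ if j < i then NN n D s j else DF s j)) ?_ ?_ s' hs'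
      · intro s' hs' hpre hD
        rw [D'old s' (hs' i)] at hD
        rcases lt_or_gt_of_ne hji with h | h
        · rw [if_pos h]
          refine ⟨s', hs', fun l hl => ?_, hD⟩
          rw [hpre l hl, Function.update_of_ne (by omega)]
        · have := hpre i h
          rw [Function.update_self] at this
          have h3 := hs' i
          omega
      · intro s' hs' h0' hpre hD
        rw [D'new s' h0'] at hD
        rcases lt_or_gt_of_ne hji with h | h
        · rw [if_pos h] at hD ⊢
          refine ⟨s', hs', fun l hl => ?_, hD⟩
          have := hpre l hl
          rwa [Function.update_of_ne (by omega), Function.update_of_ne (by omega)] at this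
        · rw [if_neg (by omega)] at hD ⊢
          by_cases he : s = s'
          · rw [he]; exact hD
          · exfalso
            have h1 : z ∈ Cs s := by
              have := VV_sub_C h hz
              rwa [hF2 s hs hs0] at this
            have h2 : q z ∈ Ds s := interior_subset ((hCD s hs hs0).2.2.2.1 ⟨z, h1, rfl⟩)
            exact disjoint_left.1 (hdis s hs hs0 s' hs' h0' he) h2
              (DFsub s' hs' h0' j h.le hj hD)
    · refine (VV_sub_C hi).trans ?_
      rw [hF2 s hs hs0]
      exact (hCD s hs hs0).2.2.2.2.1
  have : Nonempty Z := ⟨u 0⟩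
  have hu' : ∀ s, s ∈ II n' → ∃ v, v ∈ VV p q (C' s) (NN n' D' s) s L ∩
      ecl p q p (VV p q (C' s) (NN n' D' s) s L) ∧
      (s ∈ II n → dist (p v) (p (u s)) < ε) ∧
      (¬ s i < n i → dist (p v) (p (u (Function.update s i 0))) < ε) := by
    refine cases _ ?_ ?_
    · intro s hs
      obtain ⟨v, h1, h2⟩ := pick_u (Vold s hs)
      exact ⟨v, h1, fun _ => h2, fun h => absurd (hs i) h⟩
    · intro s hs h0
      obtain ⟨v, h1, h2⟩ := pick_u (Vnew s hs h0)
      refine ⟨v, h1, fun h => absurd (h i) (by simp), fun _ => ?_⟩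
      rw [upd s h0]
      exact h2
  choose! u' hu1 hu2 hu3 using hu'
  refine ⟨C', D', u', ⟨?_, ?_, ?_, ?_, ?_, ?_, ?_, hu1⟩, ?_, ?_, ?_, ?_⟩
  · intro j hj
    rw [hn'j j (by omega)]
    exact g.n1 j hj
  · intro j
    by_cases h : j = i
    · rw [h, hn'i]; omega
    · rw [hn'j j h]; exact g.npos j
  · refine cases _ ?_ ?_
    · intro s hs
      rw [C'old s (hs i)]; exact g.Ccl s hs
    · intro s hs h0 j hj
      rw [C'new s h0]
      rcases lt_trichotomy j i with h | h | h
      · rw [hF1 s hs h0 j h]; exact g.Ccl s hs j hj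
      · rw [h, hF2 s hs h0]; exact (hCD s hs h0).1
      · exact (hF4 s hs h0 j h hj).1
  · refine cases _ ?_ ?_
    · intro s hs
      rw [C'old s (hs i)]; exact g.Cd s hs
    · intro s hs h0 j hj
      rw [C'new s h0]
      rcases lt_trichotomy j i with h | h | h
      · rw [hF1 s hs h0 j h]; exact g.Cd s hs j hj
      · rw [h, hF2 s hs h0]; exact (hCD s hs h0).2.1
      · exact (hF4 s hs h0 j h hj).2.1
  · refine cases _ ?_ ?_
    · intro s hs
      rw [D'old s (hs i)]; exact g.Dcl s hs
    · intro s hs h0 j hj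
      rw [D'new s h0]
      rcases lt_trichotomy j i with h | h | h
      · rw [if_pos h]; exact g.Dcl s hs j hj
      · rw [if_neg (by omega), h, hF3 s hs h0]; exact (hCD s hs h0).2.2.1
      · rw [if_neg (by omega)]; exact (hF4 s hs h0 j h hj).2.2.1
  · refine cases _ ?_ ?_
    · intro s hs
      rw [D'old s (hs i), C'old s (hs i)]; exact g.CD s hs
    · intro s hs h0 j hj
      rw [D'new s h0, C'new s h0]
      rcases lt_trichotomy j i with h | h | h
      · rw [if_pos h, hF1 s hs h0 j h]; exact g.CD s hs j hj
      · rw [if_neg (by omega), h, hF3 s hs h0, hF2 s hs h0]; exact (hCD s hs h0).2.2.2.1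
      · rw [if_neg (by omega)]; exact (hF4 s hs h0 j h hj).2.2.2.1
  · -- disjointness
    have mixed : ∀ s ∈ II n, ∀ s' ∈ II n, s' i = 0 → ∀ j < L,
        (∀ l < j, s l = Function.update s' i (n i) l) → s j ≠ Function.update s' i (n i) j →
        Disjoint (D s j) (if j < i then D s' j else DF s' j) := by
      intro s hs s' hs' h0' j hj h1 h2
      rcases lt_trichotomy j i with h | h | h
      · rw [if_pos h]
        refine g.disj s hs s' hs' j hj (fun l hl => ?_) ?_
        · rw [h1 l hl, Function.update_of_ne (by omega)]
        · rwa [Function.update_of_ne (by omega)] at h2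
      · subst h
        rw [if_neg (lt_irrefl _), hF3 s' hs' h0']
        refine ((hCD s' hs' h0').2.2.2.2.2.1.mono_right ?_).symm
        intro y hy
        refine ⟨s, hs, fun l hl => ?_, hy⟩
        rw [h1 l hl, Function.update_of_ne (by omega)]
      · have := h1 i h
        rw [Function.update_self] at this
        have h3 := hs i
        omega
    refine cases _ ?_ ?_
    · intro s hs
      rw [D'old s (hs i)]
      refine cases _ ?_ ?_
      · intro s' hs'
        rw [D'old s' (hs' i)]
        exact g.disj s hs s' hs'
      · intro s' hs' h0' j hj h1 h2
        rw [D'new s' h0']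
        exact mixed s hs s' hs' h0' j hj h1 h2
    · intro s hs h0
      refine cases _ ?_ ?_
      · intro s' hs' j hj h1 h2
        rw [D'new s h0, D'old s' (hs' i)]
        exact (mixed s' hs' s hs h0 j hj (fun l hl => (h1 l hl).symm) h2.symm).symm
      · intro s' hs' h0' j hj h1 h2
        rw [D'new s h0, D'new s' h0']
        by_cases h : j < i
        · rw [if_pos h, if_pos h]
          refine g.disj s hs s' hs' j hj (fun l hl => ?_) ?_
          · have := h1 l hl
            rwa [Function.update_of_ne (by omega), Function.update_of_ne (by omega)] at this
          · rwa [Function.update_of_ne (by omega), Function.update_of_ne (by omega)] at h2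
        · rw [if_neg h, if_neg h]
          have hne : s ≠ s' := by rintro rfl; exact h2 rfl
          exact (hdis s hs h0 s' hs' h0' hne).mono (DFsub s hs h0 j (by omega) hj)
            (DFsub s' hs' h0' j (by omega) hj)
  · intro s hs j hj
    rw [D'old s (hs i), C'old s (hs i)]
    exact ⟨rfl, rfl⟩
  · intro s hs h0 j hj
    rw [D'new s h0, C'new s h0, if_pos hj]
    exact ⟨hF1 s hs h0 j hj, rfl⟩
  · intro s hs
    exact hu2 s (old_mem s hs).1 hs
  · intro s hs h0
    have := hu3 _ (new_mem s hs h0) (by simp)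
    rwa [upd s h0] at this


def nseq : ℕ → ℕ → ℕ
  | 0 => fun _ => 1
  | k + 1 => Function.update (nseq k) k.unpair.1 (nseq k k.unpair.1 + 1)

theorem nseq_mono (l : ℕ) : Monotone (fun k => nseq k l) := by
  refine monotone_nat_of_le_succ fun k => ?_
  by_cases h : l = k.unpair.1
  · subst h; simp [nseq]
  · simp [nseq, h]

theorem nseq_unbdd (l m : ℕ) : ∃ k, m < nseq k l := by
  induction m with
  | zero => exact ⟨0, by simp [nseq]⟩
  | succ m ih =>
    obtain ⟨K, hK⟩ := ih
    refine ⟨Nat.pair l K + 1, ?_⟩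
    have h1 : nseq K l ≤ nseq (Nat.pair l K) l := nseq_mono l (Nat.right_le_pair l K)
    simp only [nseq, Nat.unpair_pair, Function.update_self]
    omega

theorem nseq_unif (x : ℕ → ℕ) (j : ℕ) : ∃ K, j < K ∧ ∀ l ≤ j, x l < nseq K l := by
  choose k hk using fun l => nseq_unbdd l (x l)
  refine ⟨(Finset.range (j+1)).sup k + j + 1, by omega, fun l hl => (hk l).trans_le ?_⟩
  apply nseq_mono l
  have : k l ≤ (Finset.range (j+1)).sup k := Finset.le_sup (by simp; omega)
  omega

def tr (k : ℕ) (x : ℕ → ℕ) : ℕ → ℕ := fun i => if x i < nseq k i then x i else 0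

theorem tr_eq {k : ℕ} {x : ℕ → ℕ} {i : ℕ} (h : x i < nseq k i) : tr k x i = x i := by
  simp [tr, h]

theorem tr_mem (k : ℕ) (x : ℕ → ℕ) : tr k x ∈ II (nseq k) := by
  intro i
  have : 1 ≤ nseq k i := (nseq_mono i (Nat.zero_le k))
  simp only [tr]
  split_ifs <;> omega

theorem tr_succ (k : ℕ) (x : ℕ → ℕ) : tr (k+1) x = tr k x ∨ 
    (x k.unpair.1 = nseq k k.unpair.1 ∧ tr k x k.unpair.1 = 0 ∧
      tr (k+1) x = Function.update (tr k x) k.unpair.1 (nseq k k.unpair.1)) := by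
  by_cases h : x k.unpair.1 = nseq k k.unpair.1
  · right
    refine ⟨h, by simp [tr, h], ?_⟩
    funext i
    by_cases hi : i = k.unpair.1
    · subst hi; simp [tr, nseq, h]
    · simp [tr, nseq, hi]
  · left
    funext i
    by_cases hi : i = k.unpair.1
    · subst hi
      simp only [tr, nseq, Function.update_self]
      split_ifs <;> omega
    · simp [tr, nseq, hi]

theorem step_all [SecondCountableTopology Z] [SecondCountableTopology X] [SecondCountableTopology Y]
    {p : Z → X} {q : Z → Y} (hp : Continuous p) (hq : Continuous q)
    {k : ℕ} {C : (ℕ → ℕ) → ℕ → Set Z}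
    {D : (ℕ → ℕ) → ℕ → Set Y} {u : (ℕ → ℕ) → Z} (g : Good p q k (nseq k) C D u) :
    ∃ C' D' u', Good p q (k+1) (nseq (k+1)) C' D' u' ∧ ∀ x : ℕ → ℕ,
      (∀ j < k, (∀ l ≤ j, x l < nseq k l) →
        C' (tr (k+1) x) j = C (tr k x) j ∧ D' (tr (k+1) x) j = D (tr k x) j) ∧
      dist (p (u' (tr (k+1) x))) (p (u (tr k x))) < 1 * (1/2 : ℝ)^k := by
  obtain ⟨C1, D1, u1, g1, hA1, hA2⟩ := stepA hq g (ε := (1/2 : ℝ)^k/2) (by positivity)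
  obtain ⟨C2, D2, u2, g2, hB1, hB2, hB3, hB4⟩ := stepB hp hq g1 (i := k.unpair.1)
    (by have := Nat.unpair_left_le k; omega) (ε := (1/2 : ℝ)^k/2) (by positivity)
  refine ⟨C2, D2, u2, g2, fun x => ?_⟩
  have hx := tr_mem k x
  rcases tr_succ k x with h | ⟨h1, h2, h3⟩
  · rw [h]
    refine ⟨fun j hj _ => ?_, ?_⟩
    · rw [(hB1 _ hx j (by omega)).1, (hB1 _ hx j (by omega)).2]
      exact hA1 _ hx j hj
    · have e1 := hA2 _ hx
      have e2 := hB3 _ hx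
      have := dist_triangle (p (u2 (tr k x))) (p (u1 (tr k x))) (p (u (tr k x)))
      linarith
  · rw [h3]
    refine ⟨fun j hj hl => ?_, ?_⟩
    · have hji : j < k.unpair.1 := by
        by_contra hc
        have := hl k.unpair.1 (by omega)
        omega
      rw [(hB2 _ hx h2 j hji).1, (hB2 _ hx h2 j hji).2]
      exact hA1 _ hx j hj
    · have e1 := hA2 _ hx
      have e2 := hB4 _ hx h2
      have := dist_triangle (p (u2 (Function.update (tr k x) k.unpair.1 (nseq k k.unpair.1))))
        (p (u1 (tr k x))) (p (u (tr k x)))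
      linarith

theorem cantor_aux {N : ℕ} (hN : 1 ≤ N) (a : ℕ) : ∃ O : Set ℝ, IsOpen O ∧ ∀ m : ℕ,
    cantorEmbNat m ∈ O ↔ (if m < N then m else 0) = (if a < N then a else 0) := by
  have key : ∀ m c : ℕ, m ≠ 0 → (cantorEmbNat m < (2:ℝ)^(-(c:ℤ)) ↔ c < m) := by
    intro m c hm
    simp only [cantorEmbNat, hm, if_false]
    rw [zpow_lt_zpow_iff_right₀ (by norm_num)]
    omega
  have key2 : ∀ m c : ℕ, m ≠ 0 → ((2:ℝ)^(-(c:ℤ)) < cantorEmbNat m ↔ m < c) := by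
    intro m c hm
    simp only [cantorEmbNat, hm, if_false]
    rw [zpow_lt_zpow_iff_right₀ (by norm_num)]
    omega
  have k0 : cantorEmbNat 0 = 0 := by simp [cantorEmbNat]
  generalize hc : (if a < N then a else 0) = c
  have hcN : c < N := by rw [← hc]; split_ifs <;> omega
  by_cases h0 : c = 0
  · subst h0
    refine ⟨Iio ((2:ℝ)^(-((N-1 : ℕ):ℤ))), isOpen_Iio, fun m => ?_⟩
    by_cases hm : m = 0
    · subst hm
      simp only [mem_Iio, k0]
      constructor
      · intro; simp
      · intro; positivity
    · rw [mem_Iio, key m _ hm]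
      split_ifs <;> omega
  · refine ⟨Ioo ((2:ℝ)^(-((c+1 : ℕ):ℤ))) ((2:ℝ)^(-((c-1 : ℕ):ℤ))), isOpen_Ioo, fun m => ?_⟩
    by_cases hm : m = 0
    · subst hm
      simp only [mem_Ioo, k0]
      constructor
      · rintro ⟨h, _⟩
        have : (0:ℝ) < (2:ℝ)^(-((c+1 : ℕ):ℤ)) := by positivity
        linarith
      · intro h
        split_ifs at h <;> omega
    · rw [mem_Ioo, key m _ hm, key2 m _ hm]
      split_ifs <;> omega

theorem nseq_one {k i : ℕ} (h : k ≤ i) : nseq k i = 1 := by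
  induction k with
  | zero => rfl
  | succ k ih =>
    have h2 := Nat.unpair_left_le k
    have h1 : i ≠ k.unpair.1 := by omega
    simp [nseq, h1, ih (by omega)]

theorem tr_zero {k i : ℕ} (h : k ≤ i) (x : ℕ → ℕ) : tr k x i = 0 := by
  have := tr_mem k x i
  rw [nseq_one h] at this
  omega

theorem tr_open (k : ℕ) (x : ℕ → ℕ) : {y | tr k y = tr k x} ∈ @nhds _ cantorTop x := by
  have h : ∀ l : ℕ, ∃ O : Set ℝ, IsOpen O ∧ ∀ m : ℕ, cantorEmbNat m ∈ O ↔
    (if m < nseq k l then m else 0) = (if x l < nseq k l then x l else 0) := fun l =>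
    cantor_aux (nseq_mono l (Nat.zero_le k)) (x l)
  choose O hO hm using h
  rw [cantorTop, nhds_induced, Filter.mem_comap]
  refine ⟨(Finset.range k : Set ℕ).pi O, ?_, ?_⟩
  · refine IsOpen.mem_nhds (isOpen_set_pi (Finset.finite_toSet _) fun l _ => hO l) ?_
    intro l _
    exact (hm l (x l)).2 rfl
  · intro y hy
    funext l
    by_cases hl : l < k
    · exact (hm l (y l)).1 (hy l (by simpa using hl))
    · rw [tr_zero (by omega), tr_zero (by omega)]

theorem core_thm [CompleteSpace Z]
    [SecondCountableTopology Z] [SecondCountableTopology X] [SecondCountableTopology Y]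
    {p : Z → X} {q : Z → Y} (hp : Continuous p) (hq : Continuous q)
    (hns : ¬ Sm p q univ) :
    ∃ φ : (ℕ → ℕ) → Z, Continuous φ ∧ (@Continuous _ _ cantorTop _ (fun x => p (φ x))) ∧
      ∀ x j, ∃ O : Set Y, IsOpen O ∧ q (φ x) ∈ O ∧
        ∀ y, (∀ l < j, y l = x l) → q (φ y) ∈ O → y j = x j := by
  let Dat := ((ℕ → ℕ) → ℕ → Set Z) × ((ℕ → ℕ) → ℕ → Set Y) × ((ℕ → ℕ) → Z)
  let St : ℕ → Type _ := fun k => {d : Dat // Good p q k (nseq k) d.1 d.2.1 d.2.2}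
  obtain ⟨u0, hu0, hu0'⟩ := Sm.nonempty (ecl_inter_not p hns)
  let st0 : St 0 := ⟨⟨fun _ _ => ∅, fun _ _ => ∅, fun _ => u0⟩, 
    { n1 := fun _ _ => rfl
      npos := fun _ => Nat.one_pos
      Ccl := fun _ _ _ h => absurd h (Nat.not_lt_zero _)
      Cd := fun _ _ _ h => absurd h (Nat.not_lt_zero _)
      Dcl := fun _ _ _ h => absurd h (Nat.not_lt_zero _)
      CD := fun _ _ _ h => absurd h (Nat.not_lt_zero _)
      disj := fun _ _ _ _ _ h => absurd h (Nat.not_lt_zero _)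
      hu := fun _ _ => ⟨hu0, hu0'⟩ }⟩
  have hstep : ∀ k (d : St k), ∃ d' : St (k+1), ∀ x : ℕ → ℕ,
      (∀ j < k, (∀ l ≤ j, x l < nseq k l) →
        d'.1.1 (tr (k+1) x) j = d.1.1 (tr k x) j ∧ d'.1.2.1 (tr (k+1) x) j = d.1.2.1 (tr k x) j) ∧
      dist (p (d'.1.2.2 (tr (k+1) x))) (p (d.1.2.2 (tr k x))) < 1 * (1/2 : ℝ)^k := by
    intro k d
    obtain ⟨C', D', u', g, h⟩ := step_all hp hq d.2
    exact ⟨⟨⟨C', D', u'⟩, g⟩, h⟩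
  choose nx hnx using hstep
  let st : ∀ k, St k := fun k => Nat.rec st0 (fun k d => nx k d) k
  let C := fun k => (st k).1.1
  let D := fun k => (st k).1.2.1
  let u := fun k => (st k).1.2.2
  have g : ∀ k, Good p q k (nseq k) (C k) (D k) (u k) := fun k => (st k).2
  have hst : ∀ k (x : ℕ → ℕ), (∀ j < k, (∀ l ≤ j, x l < nseq k l) →
        C (k+1) (tr (k+1) x) j = C k (tr k x) j ∧ D (k+1) (tr (k+1) x) j = D k (tr k x) j) ∧
      dist (p (u (k+1) (tr (k+1) x))) (p (u k (tr k x))) < 1 * (1/2 : ℝ)^k :=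
    fun k => hnx k (st k)
  clear_value C D u
  -- stabilization
  have stab : ∀ x j K, j < K → (∀ l ≤ j, x l < nseq K l) → ∀ k, K ≤ k →
      C k (tr k x) j = C K (tr K x) j ∧ D k (tr k x) j = D K (tr K x) j := by
    intro x j K hj hl k hk
    induction k, hk using Nat.le_induction with
    | base => exact ⟨rfl, rfl⟩
    | succ k hk ih =>
      rw [← ih.1, ← ih.2]
      exact (hst k x).1 j (by omega) (fun l h => (hl l h).trans_le (nseq_mono l hk))
  have vC : ∀ x j K, j < K → (∀ l ≤ j, x l < nseq K l) → ∀ k, K ≤ k →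
      u k (tr k x) ∈ C K (tr K x) j := by
    intro x j K hj hl k hk
    rw [← (stab x j K hj hl k hk).1]
    exact VV_sub_C (by omega) ((g k).hu _ (tr_mem k x)).1
  have hlim : ∀ x, ∃ z, Filter.Tendsto (fun k => u k (tr k x)) Filter.atTop (𝓝 z) := by
    intro x
    apply cauchySeq_tendsto_of_complete
    rw [Metric.cauchySeq_iff']
    intro ε hε
    obtain ⟨j, hj⟩ := exists_pow_lt_of_lt_one hε (by norm_num : (1/2:ℝ) < 1)
    obtain ⟨K, hK, hl⟩ := nseq_unif x j
    refine ⟨K, fun k hk => lt_of_le_of_lt ?_ hj⟩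
    exact (g K).Cd _ (tr_mem K x) j hK _ (vC x j K hK hl k hk) _ (vC x j K hK hl K le_rfl)
  choose φ hφ using hlim
  have φC : ∀ x j K, j < K → (∀ l ≤ j, x l < nseq K l) → φ x ∈ C K (tr K x) j := by
    intro x j K hj hl
    refine ((g K).Ccl _ (tr_mem K x) j hj).mem_of_tendsto (hφ x) ?_
    filter_upwards [Filter.eventually_ge_atTop K] with k hk
    exact vC x j K hj hl k hk
  refine ⟨φ, ?_, ?_, ?_⟩
  · rw [continuous_iff_continuousAt]
    intro x
    rw [ContinuousAt, Metric.tendsto_nhds]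
    intro ε hε
    obtain ⟨j, hj⟩ := exists_pow_lt_of_lt_one hε (by norm_num : (1/2:ℝ) < 1)
    obtain ⟨K, hK, hl⟩ := nseq_unif x j
    have hnb : (Finset.range K : Set ℕ).pi (fun l => {x l}) ∈ 𝓝 x := by
      refine IsOpen.mem_nhds (isOpen_set_pi (Finset.finite_toSet _) fun l _ => isOpen_discrete _) ?_
      intro l _; rfl
    filter_upwards [hnb] with y hy
    have hy' : ∀ l < K, y l = x l := fun l h => hy l (by simpa using h)
    have htr : tr K y = tr K x := by
      funext l
      by_cases h : l < K
      · simp [tr, hy' l h]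
      · rw [tr_zero (by omega), tr_zero (by omega)]
    have h1 := φC y j K hK (fun l h => by rw [hy' l (by omega)]; exact hl l h)
    rw [htr] at h1
    exact lt_of_le_of_lt ((g K).Cd _ (tr_mem K x) j hK _ h1 _ (φC x j K hK hl)) hj
  · have hd : ∀ x k, dist (p (u k (tr k x))) (p (φ x)) ≤ 1 * (1/2 : ℝ)^k / (1 - 1/2) := by
      intro x k
      refine dist_le_of_le_geometric_of_tendsto (f := fun k => p (u k (tr k x))) (1/2) 1
        (by norm_num) (fun n => ?_) ((hp.tendsto _).comp (hφ x)) k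
      rw [dist_comm]
      exact (hst n x).2.le
    letI := cantorTop
    rw [continuous_iff_continuousAt]
    intro x
    rw [ContinuousAt, Metric.tendsto_nhds]
    intro ε hε
    obtain ⟨k, hk⟩ := exists_pow_lt_of_lt_one (show 0 < ε/4 by positivity)
      (by norm_num : (1/2:ℝ) < 1)
    filter_upwards [tr_open k x] with y hy
    have hy' : tr k y = tr k x := hy
    have h1 := hd x k
    have h2 := hd y k
    rw [hy'] at h2
    have h3 := dist_triangle_left (p (φ y)) (p (φ x)) (p (u k (tr k x)))
    have : 1 * (1/2 : ℝ)^k / (1 - 1/2) = 2 * (1/2 : ℝ)^k := by ring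
    rw [this] at h1 h2
    linarith
  · intro x j
    obtain ⟨K, hK, hl⟩ := nseq_unif x j
    refine ⟨interior (D K (tr K x) j), isOpen_interior,
      (g K).CD _ (tr_mem K x) j hK ⟨_, φC x j K hK hl, rfl⟩, ?_⟩
    intro y hyx hyO
    by_contra hne
    obtain ⟨K', hK', hl'⟩ := nseq_unif y j
    let M := max K K'
    have hlM : ∀ l ≤ j, x l < nseq M l := fun l h =>
      (hl l h).trans_le (nseq_mono l (le_max_left _ _))
    have hlM' : ∀ l ≤ j, y l < nseq M l := fun l h =>
      (hl' l h).trans_le (nseq_mono l (le_max_right _ _))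
    have hjM : j < M := hK.trans_le (le_max_left _ _)
    have h1 : q (φ y) ∈ D M (tr M y) j := interior_subset
      ((g M).CD _ (tr_mem M y) j hjM ⟨_, φC y j M hjM hlM', rfl⟩)
    have h2 : q (φ y) ∈ D M (tr M x) j := by
      rw [(stab x j K hK hl M (le_max_left _ _)).2]
      exact interior_subset hyO
    refine disjoint_left.1 ((g M).disj _ (tr_mem M y) _ (tr_mem M x) j hjM ?_ ?_) h1 h2
    · intro l h
      rw [tr_eq (hlM l h.le), tr_eq (hlM' l h.le), hyx l h]
    · rwa [tr_eq (hlM j le_rfl), tr_eq (hlM' j le_rfl)]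


end core


theorem core_top {Z X Y : Type} [tZ : TopologicalSpace Z] [TopologicalSpace X] [TopologicalSpace Y]
    [PolishSpace Z] [TopologicalSpace.MetrizableSpace X] [TopologicalSpace.MetrizableSpace Y]
    [SecondCountableTopology X] [SecondCountableTopology Y]
    {p : Z → X} {q : Z → Y} (hp : Continuous p) (hq : Continuous q) :
    (∃ T : ℕ → Set Z, (∀ n, ∀ z ∈ T n, ∀ O ∈ 𝓝 (q z), ∃ Q ∈ 𝓝 (p z),
        ∀ z' ∈ T n, p z' ∈ Q → q z' ∈ O) ∧ univ ⊆ ⋃ n, T n) ∨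
    ∃ φ : (ℕ → ℕ) → Z, Continuous φ ∧ (@Continuous _ _ cantorTop _ (fun x => p (φ x))) ∧
      ∀ x j, ∃ O : Set Y, IsOpen O ∧ q (φ x) ∈ O ∧
        ∀ y, (∀ l < j, y l = x l) → q (φ y) ∈ O → y j = x j := by
  letI := TopologicalSpace.upgradeIsCompletelyMetrizable Z
  letI := TopologicalSpace.metrizableSpaceMetric X
  letI := TopologicalSpace.metrizableSpaceMetric Y
  by_cases h : Sm p q univ
  · exact Or.inl h
  · exact Or.inr (core_thm hp hq h)

theorem cantor_range_compact : IsCompact (range cantorEmbNat) := by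
  have h0 : cantorEmbNat 0 = 0 := by simp [cantorEmbNat]
  have ht : Filter.Tendsto cantorEmbNat Filter.atTop (𝓝 (cantorEmbNat 0)) := by
    rw [h0]
    have h1 : Filter.Tendsto (fun n : ℕ => (1 / 2 : ℝ) ^ n) Filter.atTop (𝓝 0) :=
      tendsto_pow_atTop_nhds_zero_of_lt_one (by norm_num) (by norm_num)
    refine h1.congr' ?_
    filter_upwards [Filter.eventually_gt_atTop 0] with n hn
    simp [cantorEmbNat, hn.ne']
  have := ht.isCompact_insert_range
  rwa [insert_eq_of_mem (mem_range_self 0)] at this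

theorem cantor_compact : @CompactSpace (ℕ → ℕ) cantorTop := by
  letI := cantorTop
  have hi : IsInducing (fun (s : ℕ → ℕ) (n : ℕ) => cantorEmbNat (s n)) := ⟨rfl⟩
  refine ⟨hi.isCompact_iff.2 ?_⟩
  have := isCompact_univ_pi (fun _ : ℕ => cantor_range_compact)
  convert this using 1
  ext g
  simp only [image_univ, mem_range, mem_pi, mem_univ, true_implies]
  constructor
  · rintro ⟨s, rfl⟩ i
    exact ⟨s i, rfl⟩
  · intro h
    choose s hs using h
    exact ⟨s, funext hs⟩

theorem contGraph_of_cts {p q : (ℕ → ℕ) → Hcube} {T : Set (ℕ → ℕ)}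
    (h : ∀ z ∈ T, ∀ O ∈ 𝓝 (q z), ∃ Q ∈ 𝓝 (p z), ∀ z' ∈ T, p z' ∈ Q → q z' ∈ O) :
    IsContGraph ((fun z => (p z, q z)) '' T) := by
  classical
  have hw : ∀ z ∈ T, ∀ z' ∈ T, p z' = p z → q z' = q z := by
    intro z hz z' hz' e
    by_contra hne
    obtain ⟨Q, hQ, hQ'⟩ := h z hz {q z'}ᶜ (isOpen_compl_singleton.mem_nhds (Ne.symm hne))
    exact hQ' z' hz' (e ▸ mem_of_mem_nhds hQ) rfl
  let f : Hcube → Hcube := fun x => if hx : x ∈ p '' T then q hx.choose else x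
  have hf : ∀ z ∈ T, f (p z) = q z := by
    intro z hz
    have hx : p z ∈ p '' T := ⟨z, hz, rfl⟩
    simp only [f, dif_pos hx]
    exact hw z hz _ hx.choose_spec.1 hx.choose_spec.2
  refine ⟨p '' T, f, ?_, ?_⟩
  · rintro _ ⟨z, hz, rfl⟩
    intro O hO
    rw [hf z hz] at hO
    obtain ⟨Q, hQ, hQ'⟩ := h z hz O hO
    rw [Filter.mem_map]
    filter_upwards [mem_nhdsWithin_of_mem_nhds hQ, self_mem_nhdsWithin] with x hx hx'
    obtain ⟨z', hz', rfl⟩ := hx'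
    rw [mem_preimage, hf z' hz']
    exact hQ' z' hz' hx
  · ext ⟨a, b⟩
    constructor
    · rintro ⟨z, hz, e⟩
      obtain ⟨rfl, rfl⟩ := Prod.mk.inj e
      exact ⟨⟨z, hz, rfl⟩, (hf z hz).symm⟩
    · rintro ⟨⟨z, hz, e1⟩, e2⟩
      simp only at e1 e2
      subst e1
      exact ⟨z, hz, by rw [e2, hf z hz]⟩

theorem emb_of_compact {X Y : Type} [TopologicalSpace X] [TopologicalSpace Y] [CompactSpace X]
    [T2Space Y] {g : X → Y} (hc : Continuous g) (hi : Function.Injective g) : IsEmbedding g :=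
  (hc.isClosedEmbedding hi).isEmbedding

theorem emb_of_sep {Y : Type} [TopologicalSpace Y] {ψ : (ℕ → ℕ) → Y} (hc : Continuous ψ)
    (hs : ∀ x j, ∃ O : Set Y, IsOpen O ∧ ψ x ∈ O ∧
        ∀ y, (∀ l < j, y l = x l) → ψ y ∈ O → y j = x j) : IsEmbedding ψ := by
  have key : ∀ x m, ∃ O ∈ 𝓝 (ψ x), ∀ y, ψ y ∈ O → ∀ l < m, y l = x l := by
    intro x m
    induction m with
    | zero => exact ⟨univ, Filter.univ_mem, fun y _ l hl => absurd hl (Nat.not_lt_zero _)⟩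
    | succ m ih =>
      obtain ⟨O, hO, h⟩ := ih
      obtain ⟨O', h1, h2, h3⟩ := hs x m
      refine ⟨O ∩ O', Filter.inter_mem hO (h1.mem_nhds h2), fun y hy l hl => ?_⟩
      rcases Nat.lt_succ_iff_lt_or_eq.1 hl with hl | rfl
      · exact h y hy.1 l hl
      · exact h3 y (h y hy.1) hy.2
  refine ⟨isInducing_iff_nhds.2 fun x => le_antisymm ?_ ?_, ?_⟩
  · exact Filter.map_le_iff_le_comap.1 hc.continuousAt
  · rw [nhds_pi, Filter.pi]
    refine le_iInf fun i => ?_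
    rw [nhds_discrete ℕ, Filter.comap_pure, Filter.le_principal_iff]
    obtain ⟨O, hO, h⟩ := key x (i + 1)
    exact ⟨O, hO, fun y hy => h y hy i (Nat.lt_succ_self i)⟩
  · intro x y e
    funext i
    obtain ⟨O, hO, h⟩ := key y (i + 1)
    exact h x (e ▸ mem_of_mem_nhds hO) i (Nat.lt_succ_self i)


/-- The dichotomy in the special case of a Borel graph (Borel sets are measurable sets here,
since the Borel σ-algebra of the Hilbert cube coincides with the product σ-algebra):
either the graph can be covered by countably many graphs of continuous functions, or it
contains a copy of the Pawlikowski function `P` (the identity from `ω^ω` with the Cantor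
topology to `ω^ω` with the Baire topology). -/
theorem borel_graph_dichotomy
    (Adot Addot : Set Hcube) (hAdot : MeasurableSet Adot) (hAddot : MeasurableSet Addot)
    (A : Set (Hcube × Hcube))
    (hsub : A ⊆ Adot ×ˢ Addot)
    (hfun : ∀ x ∈ Adot, ∃! y : Hcube, (x, y) ∈ A)
    (hAborel : MeasurableSet A) :
    CoveredByCtsGraphs A ∨
      ∃ (φd φdd : (ℕ → ℕ) → Hcube),
        (∀ s, (φd s, φdd s) ∈ A) ∧
        (∀ s, φd s ∈ Adot) ∧ (∀ s, φdd s ∈ Addot) ∧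
        (@Topology.IsEmbedding (ℕ → ℕ) Hcube cantorTop _ φd) ∧
        Topology.IsEmbedding φdd := by
  have han : AnalyticSet A := hAborel.analyticSet
  rw [AnalyticSet] at han
  rcases han with rfl | ⟨f, hf, rfl⟩
  · left
    exact ⟨fun _ => ∅, fun _ => ⟨∅, id, continuousOn_empty _, by simp⟩, empty_subset _⟩
  have hp : Continuous (fun z => (f z).1) := continuous_fst.comp hf
  have hq : Continuous (fun z => (f z).2) := continuous_snd.comp hf
  rcases core_top hp hq with ⟨T, h1, h2⟩ | ⟨φ, hφ, hφc, hsep⟩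
  · left
    refine ⟨fun n => (fun z => ((f z).1, (f z).2)) '' T n, fun n => contGraph_of_cts (h1 n), ?_⟩
    rintro _ ⟨z, rfl⟩
    obtain ⟨n, hn⟩ := mem_iUnion.1 (h2 (mem_univ z))
    exact mem_iUnion.2 ⟨n, z, hn, rfl⟩
  · right
    have hmem : ∀ s, ((f (φ s)).1, (f (φ s)).2) ∈ range f := fun s => ⟨φ s, rfl⟩
    have hE : IsEmbedding (fun s => (f (φ s)).2) := emb_of_sep (hq.comp hφ) hsep
    refine ⟨fun s => (f (φ s)).1, fun s => (f (φ s)).2, hmem, fun s => (hsub (hmem s)).1,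
      fun s => (hsub (hmem s)).2, ?_, hE⟩
    have hinj : Function.Injective (fun s => (f (φ s)).1) := by
      intro x y e
      apply hE.injective
      refine (hfun _ (hsub (hmem x)).1).unique (hmem x) ?_
      simp only at e
      rw [e]
      exact hmem y
    exact @emb_of_compact _ _ cantorTop _ cantor_compact _ _ hφc hinj

end
end

section
/- Let A ⊆ Ḣ × Ḧ be the graph of a function. Every analytic I-positive set X ⊆ A contains a solid set, i.e., a nonempty analytic subset Z ⊆ X such that for every open U ⊆ Ḣ × Ḧ, either U ∩ Z = ∅ or U ∩ Z is I-positive. -/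
open MeasureTheory Metric Set Topology

noncomputable section

theorem CoveredByCtsGraphs.mono' {X Y : Set (Hcube × Hcube)} (h : X ⊆ Y)
    (hY : CoveredByCtsGraphs Y) : CoveredByCtsGraphs X := by
  obtain ⟨G, hG, hc⟩ := hY
  exact ⟨G, hG, h.trans hc⟩

theorem coveredByCtsGraphs_iUnion {X : ℕ → Set (Hcube × Hcube)}
    (h : ∀ n, CoveredByCtsGraphs (X n)) : CoveredByCtsGraphs (⋃ n, X n) := by
  choose G hG hc using h
  refine ⟨fun k => G k.unpair.1 k.unpair.2, fun k => hG _ _, ?_⟩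
  refine iUnion_subset fun n x hx => ?_
  obtain ⟨m, hm⟩ := mem_iUnion.1 (hc n hx)
  refine mem_iUnion.2 ⟨Nat.pair n m, ?_⟩
  simpa using hm

theorem coveredByCtsGraphs_empty : CoveredByCtsGraphs ∅ :=
  ⟨fun _ => ∅, fun _ => ⟨∅, id, continuousOn_empty _, by simp⟩, empty_subset _⟩

theorem coveredByCtsGraphs_union {X Y : Set (Hcube × Hcube)}
    (hX : CoveredByCtsGraphs X) (hY : CoveredByCtsGraphs Y) : CoveredByCtsGraphs (X ∪ Y) := by
  have h : CoveredByCtsGraphs (⋃ n : ℕ, if n = 0 then X else Y) :=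
    coveredByCtsGraphs_iUnion fun n => by by_cases hn : n = 0 <;> simp [hn, hX, hY]
  refine h.mono' (union_subset (fun x hx => ?_) (fun x hx => ?_))
  · exact mem_iUnion.2 ⟨0, by simpa using hx⟩
  · exact mem_iUnion.2 ⟨1, by simpa using hx⟩

/-- Every analytic `I`-positive `X ⊆ A` (`A` the graph of a function) contains a solid
set: a nonempty analytic `Z ⊆ X` such that every open `U` has `U ∩ Z = ∅` or `U ∩ Z`
`I`-positive. -/
theorem analytic_I_positive_contains_solid
    (A : Set (Hcube × Hcube))
    (hgraph : ∀ x y y' : Hcube, (x, y) ∈ A → (x, y') ∈ A → y = y')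
    (X : Set (Hcube × Hcube)) (hXA : X ⊆ A)
    (hXanal : AnalyticSet X) (hpos : ¬ CoveredByCtsGraphs X) :
    ∃ Z : Set (Hcube × Hcube), Z ⊆ X ∧ Z.Nonempty ∧ AnalyticSet Z ∧
      ∀ U : Set (Hcube × Hcube), IsOpen U →
        U ∩ Z = ∅ ∨ ¬ CoveredByCtsGraphs (U ∩ Z) := by
  set S : Set (Set (Hcube × Hcube)) := {U | IsOpen U ∧ CoveredByCtsGraphs (U ∩ X)} with hS
  obtain ⟨T, hTc, hTS, hTU⟩ := TopologicalSpace.isOpen_sUnion_countable S (fun s hs => hs.1)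
  have hW : IsOpen (⋃₀ S) := isOpen_sUnion fun s hs => hs.1
  have hcov : CoveredByCtsGraphs (⋃₀ S ∩ X) := by
    rw [← hTU]
    rcases T.eq_empty_or_nonempty with rfl | hne
    · simpa using coveredByCtsGraphs_empty
    · obtain ⟨f, rfl⟩ := hTc.exists_eq_range hne
      rw [sUnion_range, iUnion_inter]
      exact coveredByCtsGraphs_iUnion fun n => (hTS (mem_range_self n)).2
  refine ⟨X \ ⋃₀ S, sdiff_subset, ?_, ?_, ?_⟩
  · by_contra hne
    rw [not_nonempty_iff_eq_empty, sdiff_eq_empty] at hne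
    exact hpos (hcov.mono' (subset_inter hne subset_rfl))
  · have h2 : AnalyticSet (⋃₀ S)ᶜ := hW.isClosed_compl.analyticSet
    have h3 : X \ ⋃₀ S = ⋂ b : Bool, cond b X (⋃₀ S)ᶜ := by
      rw [← inter_eq_iInter, sdiff_eq]
    rw [h3]
    exact AnalyticSet.iInter fun b => by cases b <;> assumption
  · intro U hU
    by_cases hc : CoveredByCtsGraphs (U ∩ (X \ ⋃₀ S))
    · left
      have hUS : U ∈ S := by
        refine ⟨hU, (coveredByCtsGraphs_union hc hcov).mono' fun x hx => ?_⟩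
        by_cases hxS : x ∈ ⋃₀ S
        · exact Or.inr ⟨hxS, hx.2⟩
        · exact Or.inl ⟨hx.1, hx.2, hxS⟩
      rw [eq_empty_iff_forall_notMem]
      rintro x ⟨hxU, -, hxS⟩
      exact hxS ⟨U, hUS, hxU⟩
    · exact Or.inr hc

end
end
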